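/- arXiv:1102.3616 — 2 statements merged into one kernel-verified Lean document; each statement's English description precedes it below -/
import Mathlib

section
/- Let X_1, …, X_n ∈ [0,1]^d be fixed design points and let S ⊂ ℤ^d be a finite set of cardinality |S|, A > 0 a constant, and ε ≥ 0. For each sign vector ω ∈ {±1}^S, set f_ω = Σ_{k ∈ S} A ω_k φ_k, and let ℙ₀ be the distribution on ℝⁿ with density p₀(y) = Π_{i=1}^n φ(y_i) (φ the standard Gaussian density) and ℙ₁ the distribution with density p₁(y) = 2^{-|S|} Σ_{ω ∈ {±1}^S} Π_{i=1}^n φ( y_i − f_ω(X_i) ). If |n⁻¹ Σ_{i=1}^n φ_k(X_i) φ_{k'}(X_i)| ≤ ε for all distinct k, k' ∈ S, then the Kullback–Leibler divergence K(ℙ₁, ℙ₀) satisfies K(ℙ₁, ℙ₀) ≤ log ∫_{ℝⁿ} (p₁(y)/p₀(y))² p₀(y) dy ≤ 4 |S| A⁴ n² ( 1 + |S| ε / (4 n A²) ). -/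
open Real Set MeasureTheory
open scoped Classical

/-- The unit cube `[0,1]^d`. -/
def unitBox (d : ℕ) : Set (Fin d → ℝ) := Set.univ.pi fun _ => Set.Icc (0 : ℝ) 1

/-- `k ∈ (ℤ^d)₊` : the first nonzero coordinate of `k` is positive. -/
def PosLex {d : ℕ} (k : Fin d → ℤ) : Prop :=
  ∃ j : Fin d, 0 < k j ∧ ∀ i : Fin d, i < j → k i = 0

/-- The Fourier basis on `[0,1]^d`: `φ_k(x) = 1` if `k = 0`,
`√2 cos(2π k·x)` if `k ∈ (ℤ^d)₊`, and `√2 sin(2π k·x)` if `−k ∈ (ℤ^d)₊`. -/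
noncomputable def phiF {d : ℕ} (k : Fin d → ℤ) (x : Fin d → ℝ) : ℝ :=
  if k = 0 then 1
  else if PosLex k then Real.sqrt 2 * Real.cos (2 * Real.pi * ∑ i, (k i : ℝ) * x i)
  else Real.sqrt 2 * Real.sin (2 * Real.pi * ∑ i, (k i : ℝ) * x i)

/-- The standard Gaussian density `φ(t) = (2π)^{-1/2} e^{−t²/2}`. -/
noncomputable def gaussD (t : ℝ) : ℝ := (Real.sqrt (2 * Real.pi))⁻¹ * Real.exp (-(t ^ 2) / 2)

lemma gaussD_sub_eq_gaussianPDFReal (a t : ℝ) :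
    gaussD (t - a) = ProbabilityTheory.gaussianPDFReal a 1 t := by
  simp [gaussD, ProbabilityTheory.gaussianPDFReal]

lemma gaussD_pos (t : ℝ) : 0 < gaussD t := by
  unfold gaussD
  positivity

lemma integrable_prod_gaussD {ι : Type*} [Fintype ι] (m : ι → ℝ) :
    Integrable (fun y : ι → ℝ => ∏ i, gaussD (y i - m i)) := by
  simp only [gaussD_sub_eq_gaussianPDFReal]
  exact Integrable.fintype_prod (f := fun i => ProbabilityTheory.gaussianPDFReal (m i) 1)
    fun i => ProbabilityTheory.integrable_gaussianPDFReal (m i) 1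

lemma integral_prod_gaussD {ι : Type*} [Fintype ι] (m : ι → ℝ) :
    ∫ y : ι → ℝ, ∏ i, gaussD (y i - m i) = 1 := by
  simp only [gaussD_sub_eq_gaussianPDFReal]
  rw [integral_fintype_prod_volume_eq_prod
    (fun i => ProbabilityTheory.gaussianPDFReal (m i) 1)]
  exact Finset.prod_eq_one fun i _ =>
    ProbabilityTheory.integral_gaussianPDFReal_eq_one (m i) one_ne_zero

lemma gaussD_sub_mul_gaussD_sub_div (t a b : ℝ) :
    gaussD (t - a) * gaussD (t - b) / gaussD t = exp (a * b) * gaussD (t - (a + b)) := by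
  rw [div_eq_iff (gaussD_pos t).ne']
  unfold gaussD
  have h : exp (-((t - a) ^ 2) / 2) * exp (-((t - b) ^ 2) / 2)
      = exp (a * b) * exp (-((t - (a + b)) ^ 2) / 2) * exp (-(t ^ 2) / 2) := by
    rw [← exp_add, ← exp_add, ← exp_add]
    congr 1
    ring
  linear_combination (√(2 * π))⁻¹ ^ 2 * h

lemma prod_gaussD_sub_mul_div {ι : Type*} [Fintype ι] (y a b : ι → ℝ) :
    (∏ i, gaussD (y i - a i)) * (∏ i, gaussD (y i - b i)) / ∏ i, gaussD (y i)
      = exp (∑ i, a i * b i) * ∏ i, gaussD (y i - (a i + b i)) := by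
  rw [exp_sum, ← Finset.prod_mul_distrib, ← Finset.prod_div_distrib, ← Finset.prod_mul_distrib]
  exact Finset.prod_congr rfl fun i _ => gaussD_sub_mul_gaussD_sub_div _ _ _

/-- The squared likelihood ratio of a Gaussian location mixture, weighted by the centered density,
is a combination of shifted Gaussian densities. -/
lemma sq_mixture_div {ι Ω : Type*} [Fintype ι] [Fintype Ω] (w : ℝ) (m : Ω → ι → ℝ) (y : ι → ℝ) :
    ((w * ∑ ω, ∏ i, gaussD (y i - m ω i)) / ∏ i, gaussD (y i)) ^ 2 * ∏ i, gaussD (y i)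
      = w ^ 2 * ∑ ω, ∑ ω', exp (∑ i, m ω i * m ω' i) *
          ∏ i, gaussD (y i - (m ω i + m ω' i)) := by
  have h : ∏ i, gaussD (y i) ≠ 0 := (Finset.prod_pos fun i _ => gaussD_pos _).ne'
  simp only [← prod_gaussD_sub_mul_div, ← Finset.sum_div, ← Finset.mul_sum, ← Finset.sum_mul]
  field_simp

lemma integrable_sq_mixture_div {ι Ω : Type*} [Fintype ι] [Fintype Ω] (w : ℝ) (m : Ω → ι → ℝ) :
    Integrable fun y : ι → ℝ =>
      ((w * ∑ ω, ∏ i, gaussD (y i - m ω i)) / ∏ i, gaussD (y i)) ^ 2 * ∏ i, gaussD (y i) := by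
  simp only [sq_mixture_div]
  exact (integrable_finsetSum _ fun ω _ => integrable_finsetSum _ fun ω' _ =>
    (integrable_prod_gaussD fun i => m ω i + m ω' i).const_mul _).const_mul _

lemma integral_sq_mixture_div {ι Ω : Type*} [Fintype ι] [Fintype Ω] (w : ℝ) (m : Ω → ι → ℝ) :
    ∫ y : ι → ℝ,
        ((w * ∑ ω, ∏ i, gaussD (y i - m ω i)) / ∏ i, gaussD (y i)) ^ 2 * ∏ i, gaussD (y i)
      = w ^ 2 * ∑ ω, ∑ ω', exp (∑ i, m ω i * m ω' i) := by
  have hint (ω ω' : Ω) : Integrable fun y : ι → ℝ => exp (∑ i, m ω i * m ω' i) *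
      ∏ i, gaussD (y i - (m ω i + m ω' i)) :=
    (integrable_prod_gaussD fun i => m ω i + m ω' i).const_mul _
  simp only [sq_mixture_div]
  rw [integral_const_mul, integral_finsetSum _ fun ω _ => integrable_finsetSum _ fun ω' _ =>
    hint ω ω']
  congr 1
  refine Finset.sum_congr rfl fun ω _ => ?_
  rw [integral_finsetSum _ fun ω' _ => hint ω ω']
  refine Finset.sum_congr rfl fun ω' _ => ?_
  rw [integral_const_mul, integral_prod_gaussD fun i => m ω i + m ω' i, mul_one]

/-- The Kullback–Leibler divergence is at most the logarithm of the second moment of the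
likelihood ratio. -/
lemma integral_mul_log_div_le_log_integral {α : Type*} [MeasurableSpace α] {μ : Measure α}
    {p q : α → ℝ} (hp : ∀ x, 0 < p x) (hq : ∀ x, 0 < q x)
    (hp_int : Integrable p μ) (hq_int : Integrable q μ)
    (hp_one : ∫ x, p x ∂μ = 1) (hq_one : ∫ x, q x ∂μ = 1)
    (hpq : Integrable (fun x => (p x / q x) ^ 2 * q x) μ) :
    ∫ x, p x * log (p x / q x) ∂μ ≤ log (∫ x, (p x / q x) ^ 2 * q x ∂μ) := by
  set c := ∫ x, (p x / q x) ^ 2 * q x ∂μ with hc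
  have hc_one : 1 ≤ c := by
    have h : ∫ x, (2 * p x - q x) ∂μ ≤ c := by
      refine integral_mono ((hp_int.const_mul 2).sub hq_int) hpq fun x => ?_
      have h₁ : (p x / q x) * q x = p x := div_mul_cancel₀ _ (hq x).ne'
      have h₂ := mul_nonneg (sq_nonneg (p x / q x - 1)) (hq x).le
      simp only
      nlinarith
    rw [integral_sub (hp_int.const_mul 2) hq_int, integral_const_mul, hp_one, hq_one] at h
    linarith
  have hc_pos : 0 < c := by linarith
  by_cases hlog : Integrable (fun x => p x * log (p x / q x)) μ
  · have h : ∫ x, p x * log (p x / q x) ∂μ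
        ≤ ∫ x, (c⁻¹ * ((p x / q x) ^ 2 * q x) + (log c - 1) * p x) ∂μ := by
      refine integral_mono hlog ((hpq.const_mul _).add (hp_int.const_mul _)) fun x => ?_
      have hr : 0 < p x / q x := div_pos (hp x) (hq x)
      have h₁ : (p x / q x) * q x = p x := div_mul_cancel₀ _ (hq x).ne'
      have h₂ := log_le_sub_one_of_pos (div_pos hr hc_pos)
      rw [log_div hr.ne' hc_pos.ne'] at h₂
      have h₃ := mul_le_mul_of_nonneg_left h₂ (hp x).le
      have h₄ : c⁻¹ * ((p x / q x) ^ 2 * q x) = p x * (p x / q x / c) := by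
        rw [sq, mul_assoc, h₁]
        ring
      simp only
      rw [h₄]
      linarith
    rw [integral_add (hpq.const_mul _) (hp_int.const_mul _), integral_const_mul,
      integral_const_mul, ← hc, hp_one, inv_mul_cancel₀ hc_pos.ne'] at h
    linarith
  · rw [integral_undef hlog]
    exact log_nonneg hc_one

lemma phiF_sq_le_two {d : ℕ} (k : Fin d → ℤ) (x : Fin d → ℝ) : phiF k x ^ 2 ≤ 2 := by
  unfold phiF
  split_ifs
  · norm_num
  · rw [mul_pow, sq_sqrt zero_le_two]
    linarith [cos_sq_le_one (2 * π * ∑ i, (k i : ℝ) * x i)]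
  · rw [mul_pow, sq_sqrt zero_le_two]
    linarith [sin_sq_le_one (2 * π * ∑ i, (k i : ℝ) * x i)]

/-- Rademacher sums are sub-Gaussian. -/
lemma sum_exp_sum_sign_le {κ : Type*} [Fintype κ] [DecidableEq κ] (c : κ → ℝ) :
    ∑ ω : κ → Bool, exp (∑ k, c k * (if ω k then (1 : ℝ) else -1))
      ≤ 2 ^ Fintype.card κ * exp (∑ k, c k ^ 2 / 2) := by
  have h : ∑ ω : κ → Bool, exp (∑ k, c k * (if ω k then (1 : ℝ) else -1))
      = ∏ k, (2 * cosh (c k)) := by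
    simp only [exp_sum]
    rw [← Fintype.piFinset_univ, Finset.sum_prod_piFinset Finset.univ
      fun k (b : Bool) => exp (c k * (if b then (1 : ℝ) else -1))]
    refine Finset.prod_congr rfl fun k _ => ?_
    simp [cosh_eq]
    ring
  rw [h, Finset.prod_mul_distrib, Finset.prod_const, exp_sum, Finset.card_univ]
  gcongr
  exact cosh_le_exp_half_sq _

/-- The second moment of a pair of independent Rademacher vectors through a matrix with diagonal
at most `D` and off-diagonal entries at most `η` in absolute value. -/
lemma sum_sum_exp_sign_quadratic_le {κ : Type*} [Fintype κ] [DecidableEq κ]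
    (G : κ → κ → ℝ) (D η : ℝ) (hη : 0 ≤ η) (hdiag : ∀ k, |G k k| ≤ D)
    (hoff : ∀ k k', k ≠ k' → |G k k'| ≤ η) :
    ∑ ω : κ → Bool, ∑ ω' : κ → Bool, exp (∑ k, ∑ k',
        G k k' * ((if ω k then (1 : ℝ) else -1) * (if ω' k' then (1 : ℝ) else -1)))
      ≤ (2 ^ Fintype.card κ) ^ 2 *
        exp (Fintype.card κ * D ^ 2 / 2 + (Fintype.card κ) ^ 2 * η) := by
  set N := Fintype.card κ with hN
  have habs (b b' : Bool) :
      |(if b then (1 : ℝ) else -1) * (if b' then (1 : ℝ) else -1)| = 1 := by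
    cases b <;> cases b' <;> simp
  have hexp (ω ω' : κ → Bool) : (∑ k, ∑ k',
        G k k' * ((if ω k then (1 : ℝ) else -1) * (if ω' k' then (1 : ℝ) else -1)))
      ≤ (∑ k, G k k * (if ω k then (1 : ℝ) else -1) * (if ω' k then (1 : ℝ) else -1))
        + N ^ 2 * η := by
    have hentry (k k' : κ) :
        G k k' * ((if ω k then (1 : ℝ) else -1) * (if ω' k' then (1 : ℝ) else -1))
        ≤ (if k = k' then
            G k k * (if ω k then (1 : ℝ) else -1) * (if ω' k then (1 : ℝ) else -1) else 0)
          + η := by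
      by_cases hk : k = k'
      · subst hk
        rw [if_pos rfl, ← mul_assoc]
        linarith
      · rw [if_neg hk, zero_add]
        refine (le_abs_self _).trans ?_
        rw [abs_mul, habs, mul_one]
        exact hoff k k' hk
    refine (Finset.sum_le_sum fun k _ => Finset.sum_le_sum fun k' _ => hentry k k').trans ?_
    simp only [Finset.sum_add_distrib, Finset.sum_ite_eq, Finset.mem_univ, if_true,
      Finset.sum_const, Finset.card_univ, nsmul_eq_mul, ← hN]
    apply le_of_eq
    ring
  have hrow (ω : κ → Bool) : ∑ ω' : κ → Bool, exp (∑ k, ∑ k',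
        G k k' * ((if ω k then (1 : ℝ) else -1) * (if ω' k' then (1 : ℝ) else -1)))
      ≤ 2 ^ N * exp (N * D ^ 2 / 2 + N ^ 2 * η) := by
    calc _ ≤ ∑ ω' : κ → Bool, exp (∑ k, G k k * (if ω k then (1 : ℝ) else -1) *
          (if ω' k then (1 : ℝ) else -1)) * exp (N ^ 2 * η) :=
          Finset.sum_le_sum fun ω' _ => by
            rw [← exp_add]
            exact exp_le_exp.mpr (hexp ω ω')
      _ ≤ 2 ^ N * exp (∑ k, (G k k * (if ω k then (1 : ℝ) else -1)) ^ 2 / 2) *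
          exp (N ^ 2 * η) := by
          rw [← Finset.sum_mul]
          gcongr
          exact sum_exp_sum_sign_le _
      _ ≤ 2 ^ N * exp (N * D ^ 2 / 2) * exp (N ^ 2 * η) := by
          gcongr
          have hterm (k : κ) : (G k k * (if ω k then (1 : ℝ) else -1)) ^ 2 / 2 ≤ D ^ 2 / 2 := by
            have h₁ : (G k k * (if ω k then (1 : ℝ) else -1)) ^ 2 = G k k ^ 2 := by
              split_ifs <;> ring
            have h₂ := sq_le_sq' (neg_le_of_abs_le (hdiag k)) (le_of_abs_le (hdiag k))
            rw [h₁]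
            linarith
          refine (Finset.sum_le_sum fun k _ => hterm k).trans (le_of_eq ?_)
          rw [Finset.sum_const, Finset.card_univ, nsmul_eq_mul]
          ring
      _ = _ := by rw [exp_add, mul_assoc]
  refine (Finset.sum_le_sum fun ω _ => hrow ω).trans (le_of_eq ?_)
  rw [Finset.sum_const, Finset.card_univ, Fintype.card_fun, Fintype.card_bool, ← hN, nsmul_eq_mul]
  push_cast
  ring

/-- Let `ℙ₀` have density `p₀(y) = Π_i φ(y_i)` and `ℙ₁` the uniform mixture
over sign vectors `ω ∈ {±1}^S` of the product Gaussian densities with means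
`f_ω(X_i) = Σ_{k ∈ S} A ω_k φ_k(X_i)`.  If `|n⁻¹ Σ_i φ_k(X_i) φ_{k'}(X_i)| ≤ ε` for all
distinct `k, k' ∈ S`, then
`K(ℙ₁,ℙ₀) ≤ log ∫ (p₁/p₀)² p₀ ≤ 4|S|A⁴n²(1 + |S|ε/(4nA²))`, where the Kullback–Leibler
divergence is `K(ℙ₁,ℙ₀) = ∫ p₁ log(p₁/p₀)`.
Sign vectors are encoded as boolean vectors, `true ↦ +1`, `false ↦ −1`. -/
theorem kl_divergence_mixture_bound (d n : ℕ) (hn : 0 < n)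
    (X : Fin n → Fin d → ℝ) (hX : ∀ i, X i ∈ unitBox d)
    (S : Finset (Fin d → ℤ)) (A ε : ℝ) (hA : 0 < A) (hε : 0 ≤ ε)
    (horth : ∀ k ∈ S, ∀ k' ∈ S, k ≠ k' →
      |(n : ℝ)⁻¹ * ∑ i, phiF k (X i) * phiF k' (X i)| ≤ ε)
    (p₀ p₁ : (Fin n → ℝ) → ℝ)
    (hp₀ : ∀ y : Fin n → ℝ, p₀ y = ∏ i, gaussD (y i))
    (hp₁ : ∀ y : Fin n → ℝ, p₁ y =
      ((2 : ℝ) ^ S.card)⁻¹ * ∑ ω : {k // k ∈ S} → Bool,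
        ∏ i, gaussD (y i -
          ∑ k : {k // k ∈ S},
            A * (if ω k then (1 : ℝ) else -1) * phiF (k : Fin d → ℤ) (X i))) :
    (∫ y : Fin n → ℝ, p₁ y * Real.log (p₁ y / p₀ y)) ≤
        Real.log (∫ y : Fin n → ℝ, (p₁ y / p₀ y) ^ 2 * p₀ y) ∧
    Real.log (∫ y : Fin n → ℝ, (p₁ y / p₀ y) ^ 2 * p₀ y) ≤
      4 * S.card * A ^ 4 * n ^ 2 * (1 + S.card * ε / (4 * n * A ^ 2)) := by
  set m : ({k // k ∈ S} → Bool) → Fin n → ℝ := fun ω i =>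
    ∑ k : {k // k ∈ S}, A * (if ω k then (1 : ℝ) else -1) * phiF (k : Fin d → ℤ) (X i) with hm
  obtain rfl : p₀ = fun y => ∏ i, gaussD (y i) := funext hp₀
  obtain rfl : p₁ = fun y => ((2 : ℝ) ^ S.card)⁻¹ * ∑ ω, ∏ i, gaussD (y i - m ω i) := funext hp₁
  have hn' : (0 : ℝ) < n := by exact_mod_cast hn
  refine ⟨?_, ?_⟩
  · refine integral_mul_log_div_le_log_integral (fun y => ?_) (fun y => ?_) ?_ ?_ ?_ ?_
      (integrable_sq_mixture_div _ m)
    · exact mul_pos (by positivity) (Finset.sum_pos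
        (fun ω _ => Finset.prod_pos fun i _ => gaussD_pos _) Finset.univ_nonempty)
    · exact Finset.prod_pos fun i _ => gaussD_pos _
    · exact (integrable_finsetSum _ fun ω _ => integrable_prod_gaussD (m ω)).const_mul _
    · simpa using integrable_prod_gaussD (0 : Fin n → ℝ)
    · rw [integral_const_mul, integral_finsetSum _ fun ω _ => integrable_prod_gaussD (m ω)]
      simp [integral_prod_gaussD]
    · simpa using integral_prod_gaussD (0 : Fin n → ℝ)
  · rw [integral_sq_mixture_div]
    have hgram (ω ω' : {k // k ∈ S} → Bool) : ∑ i, m ω i * m ω' i =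
        ∑ k : {k // k ∈ S}, ∑ k' : {k // k ∈ S},
        (A ^ 2 * ∑ i, phiF (k : Fin d → ℤ) (X i) * phiF (k' : Fin d → ℤ) (X i)) *
          ((if ω k then (1 : ℝ) else -1) * (if ω' k' then (1 : ℝ) else -1)) := by
      simp only [hm, Finset.sum_mul_sum]
      rw [Finset.sum_comm]
      refine Finset.sum_congr rfl fun k _ => ?_
      rw [Finset.sum_comm]
      refine Finset.sum_congr rfl fun k' _ => ?_
      rw [Finset.mul_sum, Finset.sum_mul]
      exact Finset.sum_congr rfl fun i _ => by ring
    simp only [hgram]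
    have hbound := sum_sum_exp_sign_quadratic_le (fun k k' : {k // k ∈ S} =>
      A ^ 2 * ∑ i, phiF (k : Fin d → ℤ) (X i) * phiF (k' : Fin d → ℤ) (X i))
      (A ^ 2 * (2 * n)) (A ^ 2 * (n * ε)) (by positivity)
      (fun k => by
        rw [abs_of_nonneg (mul_nonneg (sq_nonneg A)
          (Finset.sum_nonneg fun i _ => mul_self_nonneg _))]
        gcongr
        refine (Finset.sum_le_sum fun i _ => (sq (phiF (k : Fin d → ℤ) (X i))).symm.trans_le
          (phiF_sq_le_two _ _)).trans (le_of_eq ?_)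
        simp [mul_comm])
      (fun k k' hk => by
        rw [abs_mul, abs_of_nonneg (sq_nonneg A)]
        gcongr
        have h := horth k k.2 k' k'.2 (Subtype.coe_ne_coe.mpr hk)
        rw [abs_mul, abs_of_pos (inv_pos.mpr hn')] at h
        rwa [inv_mul_le_iff₀ hn'] at h)
    rw [Fintype.card_coe] at hbound
    rw [log_le_iff_le_exp (mul_pos (by positivity) (Finset.sum_pos
      (fun ω _ => Finset.sum_pos (fun ω' _ => exp_pos _) Finset.univ_nonempty)
      Finset.univ_nonempty)), inv_pow, inv_mul_le_iff₀ (by positivity)]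
    refine hbound.trans ?_
    gcongr
    have hsplit : 4 * S.card * A ^ 4 * n ^ 2 * (1 + S.card * ε / (4 * n * A ^ 2))
        = 4 * S.card * A ^ 4 * n ^ 2 + (S.card : ℝ) ^ 2 * (A ^ 2 * (n * ε)) := by
      field_simp
    rw [hsplit]
    have hnonneg : 0 ≤ (S.card : ℝ) * A ^ 4 * n ^ 2 := by positivity
    linarith
end

section
/- Let d be a positive integer, S a finite subset of ℤ^d, x_1, …, x_n points of [0,1]^d, A > 0 and ε ≥ 0. Set b_{k,k'} = A² Σ_{i=1}^n φ_k(x_i) φ_{k'}(x_i) for k, k' ∈ S and assume |n⁻¹ Σ_{i=1}^n φ_k(x_i) φ_{k'}(x_i)| ≤ ε for all distinct k, k' ∈ S. Then 0 ≤ b_{k,k} ≤ 2 A² n for every k ∈ S, |b_{k,k'}| ≤ A² n ε for all distinct k, k' ∈ S, and 2^{−2|S|} Σ_{ω, ω' ∈ {±1}^S} Π_{k, k' ∈ S} exp( ω_k ω'_{k'} b_{k,k'} ) ≤ exp( 4 |S| A⁴ n² ( 1 + |S| ε / (4 n A²) ) ). -/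
open Real Set MeasureTheory
open scoped Classical

/-- The sign `±1` encoded by a boolean. -/
local notation "sgn(" a ")" => (if a then (1 : ℝ) else -1)

lemma phiF_sq_le {d : ℕ} (k : Fin d → ℤ) (x : Fin d → ℝ) : phiF k x * phiF k x ≤ 2 := by
  have h2 : Real.sqrt 2 * Real.sqrt 2 = 2 := Real.mul_self_sqrt (by norm_num)
  unfold phiF
  split_ifs
  · norm_num
  · rw [mul_mul_mul_comm, h2]
    nlinarith [Real.cos_sq_le_one (2 * Real.pi * ∑ i, (k i : ℝ) * x i)]
  · rw [mul_mul_mul_comm, h2]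
    nlinarith [Real.sin_sq_le_one (2 * Real.pi * ∑ i, (k i : ℝ) * x i)]

lemma sum_bool_exp_sign_mul_le (a : Bool) (c : ℝ) :
    ∑ a' : Bool, Real.exp (sgn(a) * sgn(a') * c) ≤ 2 * Real.exp (c ^ 2 / 2) := by
  have h := Real.cosh_le_exp_half_sq c
  rw [Real.cosh_eq] at h
  cases a <;> simp <;> linarith

lemma sign_mul_sign_mul_le_abs (a a' : Bool) (c : ℝ) : sgn(a) * sgn(a') * c ≤ |c| := by
  cases a <;> cases a' <;> simp [le_abs_self, neg_le_abs]

/-- Exponential moment bound for a Rademacher chaos `∑ ω_i ω'_j B_{ij}` (decoupled), unnormalised,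
in terms of bounds on the diagonal and off-diagonal entries of `B`. -/
lemma sum_sign_prod_exp_le {ι : Type*} [Fintype ι] [DecidableEq ι] (B : ι → ι → ℝ) {D C : ℝ}
    (hC : 0 ≤ C) (hD : ∀ i, |B i i| ≤ D) (hB : ∀ i j, i ≠ j → |B i j| ≤ C) :
    ∑ ω : ι → Bool, ∑ ω' : ι → Bool, ∏ i, ∏ j, Real.exp (sgn(ω i) * sgn(ω' j) * B i j)
      ≤ 2 ^ (2 * Fintype.card ι) *
        Real.exp (Fintype.card ι * (D ^ 2 / 2) + Fintype.card ι ^ 2 * C) := by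
  have pointwise (ω ω' : ι → Bool) :
      ∏ i, ∏ j, Real.exp (sgn(ω i) * sgn(ω' j) * B i j) ≤
        (∏ i, Real.exp (sgn(ω i) * sgn(ω' i) * B i i)) * Real.exp (Fintype.card ι ^ 2 * C) := by
    have row (i : ι) : ∑ j, sgn(ω i) * sgn(ω' j) * B i j ≤
        sgn(ω i) * sgn(ω' i) * B i i + Fintype.card ι * C := by
      calc ∑ j, sgn(ω i) * sgn(ω' j) * B i j
          ≤ ∑ j, ((if j = i then sgn(ω i) * sgn(ω' i) * B i i else 0) + C) := by
            refine Finset.sum_le_sum fun j _ => ?_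
            by_cases h : j = i
            · subst h
              rw [if_pos rfl]
              linarith
            · rw [if_neg h, zero_add]
              exact (sign_mul_sign_mul_le_abs _ _ _).trans (hB i j (Ne.symm h))
        _ = _ := by
            rw [Finset.sum_add_distrib, Finset.sum_ite_eq' Finset.univ i]
            simp
    simp_rw [← Real.exp_sum]
    rw [← Real.exp_add]
    refine Real.exp_le_exp.2 ((Finset.sum_le_sum fun i _ => row i).trans_eq ?_)
    rw [Finset.sum_add_distrib, Finset.sum_const, Finset.card_univ, nsmul_eq_mul]
    ring
  have diagonal (ω : ι → Bool) :
      ∑ ω' : ι → Bool, ∏ i, Real.exp (sgn(ω i) * sgn(ω' i) * B i i) ≤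
        2 ^ Fintype.card ι * Real.exp (Fintype.card ι * (D ^ 2 / 2)) := by
    calc ∑ ω' : ι → Bool, ∏ i, Real.exp (sgn(ω i) * sgn(ω' i) * B i i)
        = ∏ i, ∑ a' : Bool, Real.exp (sgn(ω i) * sgn(a') * B i i) :=
          (Fintype.prod_sum fun i (a' : Bool) => Real.exp (sgn(ω i) * sgn(a') * B i i)).symm
      _ ≤ ∏ _i : ι, 2 * Real.exp (D ^ 2 / 2) := by
          refine Finset.prod_le_prod (fun i _ => by positivity) fun i _ => ?_
          refine (sum_bool_exp_sign_mul_le _ _).trans ?_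
          have := sq_le_sq' (neg_le_of_abs_le (hD i)) (le_of_abs_le (hD i))
          gcongr
      _ = _ := by
          rw [Finset.prod_const, Finset.card_univ, mul_pow, ← Real.exp_nat_mul]
  calc _ ≤ ∑ _ω : ι → Bool, 2 ^ Fintype.card ι * Real.exp (Fintype.card ι * (D ^ 2 / 2)) *
        Real.exp (Fintype.card ι ^ 2 * C) := by
        refine Finset.sum_le_sum fun ω _ => ?_
        refine (Finset.sum_le_sum fun ω' _ => pointwise ω ω').trans ?_
        rw [← Finset.sum_mul]
        exact mul_le_mul_of_nonneg_right (diagonal ω) (Real.exp_nonneg _)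
    _ = _ := by
        rw [Finset.sum_const, Finset.card_univ, Fintype.card_fun, Fintype.card_bool, nsmul_eq_mul,
          Real.exp_add]
        push_cast
        ring

/-- With `b_{k,k'} = A² Σ_i φ_k(x_i) φ_{k'}(x_i)` and
`|n⁻¹ Σ_i φ_k(x_i) φ_{k'}(x_i)| ≤ ε` for distinct `k, k' ∈ S`: `0 ≤ b_{k,k} ≤ 2A²n`,
`|b_{k,k'}| ≤ A²nε` for `k ≠ k'`, and
`2^{−2|S|} Σ_{ω,ω'} Π_{k,k' ∈ S} exp(ω_k ω'_{k'} b_{k,k'}) ≤ exp(4|S|A⁴n²(1 + |S|ε/(4nA²)))`.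
Sign vectors are encoded as boolean vectors, `true ↦ +1`, `false ↦ −1`. -/
theorem rademacher_cross_term_bound (d n : ℕ) (hn : 0 < n)
    (S : Finset (Fin d → ℤ)) (x : Fin n → Fin d → ℝ) (hx : ∀ i, x i ∈ unitBox d)
    (A ε : ℝ) (hA : 0 < A) (hε : 0 ≤ ε)
    (b : (Fin d → ℤ) → (Fin d → ℤ) → ℝ)
    (hb : ∀ k k' : Fin d → ℤ, b k k' = A ^ 2 * ∑ i, phiF k (x i) * phiF k' (x i))
    (horth : ∀ k ∈ S, ∀ k' ∈ S, k ≠ k' →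
      |(n : ℝ)⁻¹ * ∑ i, phiF k (x i) * phiF k' (x i)| ≤ ε) :
    (∀ k ∈ S, 0 ≤ b k k ∧ b k k ≤ 2 * A ^ 2 * n) ∧
    (∀ k ∈ S, ∀ k' ∈ S, k ≠ k' → |b k k'| ≤ A ^ 2 * n * ε) ∧
    ((2 : ℝ) ^ (2 * S.card))⁻¹ *
        ∑ ω : {k // k ∈ S} → Bool, ∑ ω' : {k // k ∈ S} → Bool,
          ∏ k : {k // k ∈ S}, ∏ k' : {k // k ∈ S},
            Real.exp ((if ω k then (1 : ℝ) else -1) * (if ω' k' then (1 : ℝ) else -1) *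
              b (k : Fin d → ℤ) (k' : Fin d → ℤ))
      ≤ Real.exp (4 * S.card * A ^ 4 * n ^ 2 * (1 + S.card * ε / (4 * n * A ^ 2))) := by
  have hn' : (0 : ℝ) < n := Nat.cast_pos.2 hn
  have diag : ∀ k ∈ S, 0 ≤ b k k ∧ b k k ≤ 2 * A ^ 2 * n := by
    intro k _
    rw [hb]
    constructor
    · exact mul_nonneg (sq_nonneg A) (Finset.sum_nonneg fun i _ => mul_self_nonneg _)
    · have h : ∑ i, phiF k (x i) * phiF k (x i) ≤ ∑ _i : Fin n, (2 : ℝ) :=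
        Finset.sum_le_sum fun i _ => phiF_sq_le k (x i)
      rw [Finset.sum_const, Finset.card_univ, Fintype.card_fin, nsmul_eq_mul] at h
      nlinarith [mul_le_mul_of_nonneg_left h (sq_nonneg A)]
  have offDiag : ∀ k ∈ S, ∀ k' ∈ S, k ≠ k' → |b k k'| ≤ A ^ 2 * n * ε := by
    intro k hk k' hk' hne
    have h := horth k hk k' hk' hne
    rw [abs_mul, abs_of_pos (inv_pos.2 hn'), inv_mul_le_iff₀ hn'] at h
    rw [hb, abs_mul, abs_of_nonneg (sq_nonneg A), mul_assoc]
    exact mul_le_mul_of_nonneg_left h (sq_nonneg A)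
  refine ⟨diag, offDiag, ?_⟩
  have key := sum_sign_prod_exp_le (fun k k' : {k // k ∈ S} => b k k')
    (D := 2 * A ^ 2 * n) (C := A ^ 2 * n * ε) (by positivity)
    (fun k => (abs_of_nonneg (diag k k.2).1).trans_le (diag k k.2).2)
    (fun k k' h => offDiag k k.2 k' k'.2 (Subtype.coe_injective.ne h))
  rw [Fintype.card_coe] at key
  rw [inv_mul_le_iff₀ (by positivity)]
  refine le_trans (by convert key) (mul_le_mul_of_nonneg_left (Real.exp_le_exp.2 ?_) (by positivity))
  have hrhs : 4 * S.card * A ^ 4 * n ^ 2 * (1 + S.card * ε / (4 * n * A ^ 2)) =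
      4 * S.card * A ^ 4 * n ^ 2 + (S.card : ℝ) ^ 2 * (A ^ 2 * n * ε) := by
    field_simp
  have hpos : 0 ≤ (S.card : ℝ) * A ^ 4 * n ^ 2 := by positivity
  rw [hrhs]
  nlinarith
end
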